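/- (Recursive decomposition, formula (23).) Let n ≥ 2, let a, b_1,…,b_n, c_1,…,c_n be real with no c_k a nonpositive integer, and let z_1,…,z_n be real with |z_1|+⋯+|z_n| < 1. Then F_A^(n)(a; b_1,…,b_n; c_1,…,c_n; z_1,…,z_n) equals the absolutely convergent sum over all (m_2,…,m_n) ∈ ℕ^{n−1} of [(a)_M (b_1)_M ∏_{j=2}^n (b_j)_{m_j}] / [m_2!⋯m_n! · (c_1)_M ∏_{j=2}^n (c_j)_{m_j}] · z_1^M z_2^{m_2}⋯z_n^{m_n} · F(a+M, b_1+M; c_1+M; z_1) · F_A^(n−1)(a+M; b_2+m_2,…,b_n+m_n; c_2+m_2,…,c_n+m_n; z_2,…,z_n), where M = m_2+⋯+m_n. -/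

import Mathlib

open Finset Real Filter

/-- Pochhammer symbol `(μ)_p = μ(μ+1)⋯(μ+p−1)`. -/
noncomputable def poch (μ : ℝ) (p : ℕ) : ℝ := (ascPochhammer ℝ p).eval μ

/-- `x` is not a nonpositive integer. -/
def NotNonposInt (x : ℝ) : Prop := ∀ j : ℕ, x ≠ -(j : ℝ)

/-- Gauss hypergeometric series `F(a,b;c;z) = Σ_p (a)_p (b)_p z^p / (p! (c)_p)`. -/
noncomputable def gaussF (a b c z : ℝ) : ℝ :=
  ∑' p : ℕ, poch a p * poch b p / ((Nat.factorial p : ℝ) * poch c p) * z ^ p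

/-- General term of the Lauricella hypergeometric series `F_A^(n)`. -/
noncomputable def lauricellaTerm {n : ℕ} (a : ℝ) (b c z : Fin n → ℝ) (p : Fin n → ℕ) : ℝ :=
  poch a (∑ k, p k) *
    ∏ k, poch (b k) (p k) / poch (c k) (p k) * z k ^ p k / (Nat.factorial (p k) : ℝ)

/-- Lauricella hypergeometric series `F_A^(n)(a; b; c; z)`. -/
noncomputable def lauricella {n : ℕ} (a : ℝ) (b c z : Fin n → ℝ) : ℝ :=
  ∑' p : Fin n → ℕ, lauricellaTerm a b c z p

theorem poch_zero (x : ℝ) : poch x 0 = 1 := by simp [poch]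

theorem poch_add (x : ℝ) (m n : ℕ) : poch x (m + n) = poch x m * poch (x + m) n := by
  simp only [poch, ← ascPochhammer_mul ℝ m n, Polynomial.eval_mul, Polynomial.eval_comp,
    Polynomial.eval_add, Polynomial.eval_X, Polynomial.eval_natCast]

theorem poch_succ (x : ℝ) (n : ℕ) : poch x (n + 1) = poch x n * (x + n) := by
  simp [poch, ascPochhammer_succ_eval]

theorem poch_one (n : ℕ) : poch 1 n = (n.factorial : ℝ) := by
  simp [poch, ascPochhammer_eval_one]

theorem poch_nonneg {x : ℝ} (hx : 0 ≤ x) (n : ℕ) : 0 ≤ poch x n := by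
  induction n with
  | zero => simp [poch_zero]
  | succ n ih => rw [poch_succ]; positivity

theorem abs_poch_le {x y : ℝ} (h : |x| ≤ y) (n : ℕ) : |poch x n| ≤ poch y n := by
  have hy : 0 ≤ y := (abs_nonneg x).trans h
  induction n with
  | zero => simp [poch_zero]
  | succ n ih =>
    rw [poch_succ, poch_succ, abs_mul]
    refine mul_le_mul ih ?_ (abs_nonneg _) (poch_nonneg hy n)
    calc |x + n| ≤ |x| + |(n : ℝ)| := abs_add_le _ _
      _ ≤ y + n := by rw [Nat.abs_cast]; gcongr

/-- Ratios of Pochhammer symbols grow subexponentially. -/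
theorem exists_abs_poch_div_poch_le (b c : ℝ) {ρ : ℝ} (hρ : 1 < ρ) :
    ∃ C : ℝ, 0 ≤ C ∧ ∀ n : ℕ, |poch b n / poch c n| ≤ C * ρ ^ n := by
  have hρ0 : 0 < ρ := by linarith
  have hlim : Tendsto (fun n : ℕ => (b + n) / (c + n)) atTop (nhds 1) := by
    have := tendsto_add_mul_div_add_mul_atTop_nhds (𝕜 := ℝ) b c 1 (d := 1) one_ne_zero
    simpa using this
  have hlim' : Tendsto (fun n : ℕ => |(b + n) / (c + n)| / ρ) atTop (nhds (1 / ρ)) := by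
    simpa using hlim.abs.div_const ρ
  obtain ⟨r, hr1, hr2⟩ := exists_between ((div_lt_one hρ0).2 hρ)
  have hs : Summable fun n : ℕ => poch b n / poch c n / ρ ^ n := by
    refine summable_of_ratio_norm_eventually_le hr2 ?_
    filter_upwards [hlim'.eventually_le_const hr1] with n hn
    have : poch b (n + 1) / poch c (n + 1) / ρ ^ (n + 1) =
        ((b + n) / (c + n) / ρ) * (poch b n / poch c n / ρ ^ n) := by
      rw [poch_succ, poch_succ, pow_succ, mul_div_mul_comm, mul_div_mul_comm]; ring
    rw [this, norm_mul]
    refine mul_le_mul_of_nonneg_right ?_ (norm_nonneg _)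
    rwa [Real.norm_eq_abs, abs_div, abs_of_pos hρ0]
  obtain ⟨C, hC⟩ := hs.tendsto_atTop_zero.abs.bddAbove_range
  have hC' : ∀ n, |poch b n / poch c n / ρ ^ n| ≤ C := fun n => hC ⟨n, rfl⟩
  refine ⟨C, (abs_nonneg _).trans (hC' 0), fun n => ?_⟩
  have := hC' n
  rwa [abs_div, abs_of_pos (pow_pos hρ0 n), div_le_iff₀ (pow_pos hρ0 n)] at this

theorem summable_poch_div_factorial_mul_pow (x : ℝ) {y : ℝ} (hy0 : 0 ≤ y) (hy : y < 1) :
    Summable fun n : ℕ => poch x n / (n.factorial : ℝ) * y ^ n := by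
  have hρ : 1 < 2 / (1 + y) := by rw [lt_div_iff₀ (by linarith)]; linarith
  obtain ⟨C, -, hC⟩ := exists_abs_poch_div_poch_le x 1 hρ
  have hρy : 2 / (1 + y) * y < 1 := by
    rw [div_mul_eq_mul_div, div_lt_one (by linarith)]; linarith
  refine Summable.of_norm_bounded
    (g := fun n => C * (2 / (1 + y) * y) ^ n)
    ((summable_geometric_of_lt_one (by positivity) hρy).mul_left C) fun n => ?_
  have := hC n
  rw [poch_one] at this
  rw [Real.norm_eq_abs, abs_mul, abs_of_nonneg (pow_nonneg hy0 n), mul_pow, ← mul_assoc]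
  gcongr

theorem sum_piAntidiag_poch_mul_prod (x : ℝ) {n : ℕ} (y : Fin n → ℝ) (m : ℕ) :
    ∑ p ∈ piAntidiag univ m, poch x (∑ k, p k) * ∏ k, y k ^ p k / ((p k).factorial : ℝ) =
      poch x m / (m.factorial : ℝ) * (∑ k, y k) ^ m := by
  rw [sum_pow_eq_sum_piAntidiag, mul_sum]
  refine sum_congr rfl fun p hp => ?_
  have hm : ∑ k, p k = m := (mem_piAntidiag.1 hp).1
  have h := Nat.multinomial_spec univ p
  rw [hm] at h ⊢
  have h' : (∏ k, ((p k).factorial : ℝ)) * (Nat.multinomial univ p : ℝ) = m.factorial := by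
    exact_mod_cast h
  have h0 : (∏ k, ((p k).factorial : ℝ)) ≠ 0 := prod_ne_zero_iff.2 fun k _ => by positivity
  have h1 : (m.factorial : ℝ) ≠ 0 := by positivity
  rw [prod_div_distrib]
  field_simp
  rw [← h']
  ring

theorem summable_poch_mul_prod {x : ℝ} (hx : 0 ≤ x) {n : ℕ} {y : Fin n → ℝ} (hy0 : ∀ k, 0 ≤ y k)
    (hy : ∑ k, y k < 1) :
    Summable fun p : Fin n → ℕ =>
      poch x (∑ k, p k) * ∏ k, y k ^ p k / ((p k).factorial : ℝ) := by
  have hnn : ∀ p : Fin n → ℕ,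
      0 ≤ poch x (∑ k, p k) * ∏ k, y k ^ p k / ((p k).factorial : ℝ) := fun p =>
    mul_nonneg (poch_nonneg hx _) (prod_nonneg fun k _ =>
      div_nonneg (pow_nonneg (hy0 k) _) (Nat.cast_nonneg _))
  have hY0 : 0 ≤ ∑ k, y k := sum_nonneg fun k _ => hy0 k
  have hs := summable_poch_div_factorial_mul_pow x hY0 hy
  refine summable_of_sum_le hnn (c := ∑' m : ℕ, poch x m / (m.factorial : ℝ) * (∑ k, y k) ^ m)
    fun T => ?_
  rw [← sum_fiberwise_of_maps_to (t := T.image fun p => ∑ k, p k)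
    fun p hp => mem_image_of_mem _ hp]
  refine (sum_le_sum fun m _ => ?_).trans
    (hs.sum_le_tsum _ fun m _ => mul_nonneg
      (div_nonneg (poch_nonneg hx m) (Nat.cast_nonneg _)) (pow_nonneg hY0 m))
  rw [← sum_piAntidiag_poch_mul_prod]
  refine sum_le_sum_of_subset_of_nonneg (fun p hp => ?_) fun p _ _ => hnn p
  simpa [mem_piAntidiag] using (mem_filter.1 hp).2

/-- A form of the Chu–Vandermonde identity. -/
theorem sum_choose_mul_descFactorial_mul_poch (S : ℕ) : ∀ (a : ℝ) (P : ℕ),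
    ∑ M ∈ range (S + 1), (S.choose M : ℝ) * ((P.descFactorial M : ℝ) * poch (a + M) (S - M)) =
      poch (a + P) S := by
  induction S with
  | zero => intro a P; simp [poch_zero]
  | succ S ih =>
    intro a P
    have h1 : ∑ M ∈ range (S + 1), (S.choose M : ℝ) *
        ((P.descFactorial M : ℝ) * poch (a + M) (S + 1 - M)) = (a + S) * poch (a + P) S := by
      rw [← ih a P, mul_sum]
      refine sum_congr rfl fun M hM => ?_
      have hM' : M ≤ S := Nat.lt_succ_iff.1 (mem_range.1 hM)
      rw [Nat.succ_sub hM', Nat.succ_eq_add_one, poch_succ, Nat.cast_sub hM']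
      ring
    have h2 : ∑ M ∈ range (S + 1), (S.choose M : ℝ) *
        ((P.descFactorial (M + 1) : ℝ) * poch (a + (M + 1 : ℕ)) (S - M)) =
          P * poch (a + P) S := by
      cases P with
      | zero => simp
      | succ Q =>
        have e : a + ((Q + 1 : ℕ) : ℝ) = a + 1 + Q := by push_cast; ring
        rw [e, ← ih (a + 1) Q, mul_sum]
        refine sum_congr rfl fun M _ => ?_
        rw [Nat.succ_descFactorial_succ]
        have e' : a + ((M + 1 : ℕ) : ℝ) = a + 1 + M := by push_cast; ring
        rw [e']
        push_cast
        ring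
    rw [poch_succ, sum_range_succ']
    have h3 : ∀ M ∈ range (S + 1), ((S + 1).choose (M + 1) : ℝ) *
        ((P.descFactorial (M + 1) : ℝ) * poch (a + (M + 1 : ℕ)) (S + 1 - (M + 1))) =
        (S.choose M : ℝ) * ((P.descFactorial (M + 1) : ℝ) * poch (a + (M + 1 : ℕ)) (S - M)) +
        (S.choose (M + 1) : ℝ) *
          ((P.descFactorial (M + 1) : ℝ) * poch (a + (M + 1 : ℕ)) (S + 1 - (M + 1))) := by
      intro M _
      rw [Nat.choose_succ_succ, Nat.add_sub_add_right]
      push_cast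
      ring
    rw [sum_congr rfl h3, sum_add_distrib, h2, add_assoc]
    have h4 := sum_range_succ' (fun M => (S.choose M : ℝ) *
        ((P.descFactorial M : ℝ) * poch (a + M) (S + 1 - M))) (S + 1)
    rw [sum_range_succ, h1] at h4
    simp only [Nat.choose_succ_self, Nat.cast_zero, zero_mul, add_zero, Nat.choose_zero_right]
      at h4 ⊢
    rw [← h4]
    ring

/-- The multivariate Vandermonde convolution, weighted by a function of the total degree. -/
theorem sum_prod_choose_mul {N : ℕ} (s : Fin N → ℕ) (g : ℕ → ℝ) :
    ∑ q ∈ Fintype.piFinset fun j => range (s j + 1),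
      (∏ j, ((s j).choose (q j) : ℝ)) * g (∑ j, q j) =
    ∑ M ∈ range (∑ j, s j + 1), ((∑ j, s j).choose M : ℝ) * g M := by
  let L : Polynomial ℝ →ₗ[ℝ] ℝ := Polynomial.lsum fun m => (LinearMap.id (R := ℝ)).smulRight (g m)
  have hL : ∀ (r : ℝ) (m : ℕ), L (Polynomial.C r * Polynomial.X ^ m) = r * g m := by
    intro r m
    simp [L, Polynomial.C_mul_X_pow_eq_monomial, Polynomial.sum_monomial_index]
  have hpow : ∀ m : ℕ, (Polynomial.X + 1 : Polynomial ℝ) ^ m =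
      ∑ i ∈ range (m + 1), Polynomial.C (m.choose i : ℝ) * Polynomial.X ^ i := by
    intro m
    rw [add_pow]
    exact sum_congr rfl fun i _ => by simp [mul_comm]
  have key := congrArg L (prod_pow_eq_pow_sum univ s (Polynomial.X + 1 : Polynomial ℝ))
  simp only [hpow, prod_univ_sum, prod_mul_distrib, prod_pow_eq_pow_sum, ← map_prod, map_sum,
    hL] at key
  exact key

/-- The coefficient attached to `q` when `(a)_{P+|s|}` is expanded by Chu–Vandermonde. -/
noncomputable def pochKernel {N : ℕ} (a : ℝ) (P : ℕ) (s q : Fin N → ℕ) : ℝ :=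
  poch a P * ((∏ j, ((s j).choose (q j) : ℝ)) *
    ((P.descFactorial (∑ j, q j) : ℝ) * poch (a + (∑ j, q j : ℕ)) (∑ j, s j - ∑ j, q j)))

theorem hasSum_pochKernel {N : ℕ} (a : ℝ) (P : ℕ) (s : Fin N → ℕ) :
    HasSum (pochKernel a P s) (poch a (P + ∑ j, s j)) := by
  have h : ∑ q ∈ Fintype.piFinset fun j => range (s j + 1), pochKernel a P s q =
      poch a (P + ∑ j, s j) := by
    simp only [pochKernel]
    rw [← mul_sum, sum_prod_choose_mul s fun M =>
      (P.descFactorial M : ℝ) * poch (a + M) (∑ j, s j - M),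
      sum_choose_mul_descFactorial_mul_poch, poch_add]
  rw [← h]
  refine hasSum_sum_of_ne_finset_zero fun q hq => ?_
  obtain ⟨j, hj⟩ : ∃ j, s j < q j := by
    simpa [Fintype.mem_piFinset, Nat.lt_succ_iff] using hq
  have : ∏ j, ((s j).choose (q j) : ℝ) = 0 :=
    prod_eq_zero (mem_univ j) (by rw [Nat.choose_eq_zero_of_lt hj, Nat.cast_zero])
  simp [pochKernel, this]

theorem abs_pochKernel_le {N : ℕ} (a : ℝ) (P : ℕ) (s q : Fin N → ℕ) :
    |pochKernel a P s q| ≤ pochKernel |a| P s q := by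
  have h : |a + (∑ j, q j : ℕ)| ≤ |a| + (∑ j, q j : ℕ) :=
    (abs_add_le _ _).trans (by rw [Nat.abs_cast])
  have hc : 0 ≤ ∏ j, ((s j).choose (q j) : ℝ) := prod_nonneg fun _ _ => Nat.cast_nonneg _
  simp only [pochKernel, abs_mul, Nat.abs_cast, abs_of_nonneg hc]
  refine mul_le_mul (abs_poch_le le_rfl P) ?_ (by positivity) (poch_nonneg (abs_nonneg a) P)
  exact mul_le_mul_of_nonneg_left
    (mul_le_mul_of_nonneg_left (abs_poch_le h _) (Nat.cast_nonneg _)) hc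

theorem pochKernel_add {N : ℕ} (a : ℝ) (p : ℕ) (q r : Fin N → ℕ) :
    pochKernel a (∑ j, q j + p) (q + r) q =
      poch a (∑ j, q j) * poch (a + (∑ j, q j : ℕ)) p * poch (a + (∑ j, q j : ℕ)) (∑ j, r j) *
      (((∑ j, q j + p).factorial : ℝ) / (p.factorial : ℝ)) *
      ∏ j, ((q j + r j).factorial : ℝ) / ((q j).factorial * (r j).factorial : ℝ) := by
  have h1 : ((∑ j, q j + p).descFactorial (∑ j, q j) : ℝ) =
      ((∑ j, q j + p).factorial : ℝ) / (p.factorial : ℝ) := by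
    rw [eq_div_iff (by positivity)]
    have := Nat.factorial_mul_descFactorial (Nat.le_add_right (∑ j, q j) p)
    rw [Nat.add_sub_cancel_left] at this
    rw [mul_comm]
    exact_mod_cast this
  have h2 : ∀ j, (((q + r) j).choose (q j) : ℝ) =
      ((q j + r j).factorial : ℝ) / ((q j).factorial * (r j).factorial : ℝ) :=
    fun j => Nat.cast_add_choose ℝ
  have h3 : ∑ j, (q + r) j - ∑ j, q j = ∑ j, r j := by
    simp [sum_add_distrib]
  simp only [pochKernel, h1, h2, h3, poch_add]
  ring

theorem pochKernel_ne_zero {N : ℕ} {a : ℝ} {P : ℕ} {s q : Fin N → ℕ}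
    (h : pochKernel a P s q ≠ 0) : q ≤ s ∧ ∑ j, q j ≤ P := by
  refine ⟨fun j => ?_, ?_⟩
  · by_contra! hj
    refine h ?_
    have : ∏ j, ((s j).choose (q j) : ℝ) = 0 :=
      prod_eq_zero (mem_univ j) (by rw [Nat.choose_eq_zero_of_lt hj, Nat.cast_zero])
    simp [pochKernel, this]
  · by_contra! hP
    exact h (by simp [pochKernel, Nat.descFactorial_eq_zero_iff_lt.2 hP])

/-- The factor of `lauricellaTerm` not involving the parameter `a`. -/
noncomputable def lauricellaWeight {n : ℕ} (b c z : Fin n → ℝ) (p : Fin n → ℕ) : ℝ :=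
  ∏ k, poch (b k) (p k) / poch (c k) (p k) * z k ^ p k / (Nat.factorial (p k) : ℝ)

theorem exists_abs_lauricellaWeight_le {n : ℕ} (b c z : Fin n → ℝ) {ρ : ℝ} (hρ : 1 < ρ) :
    ∃ C : ℝ, ∀ p, |lauricellaWeight b c z p| ≤
      C * ∏ k, (ρ * |z k|) ^ p k / ((p k).factorial : ℝ) := by
  choose C hC0 hC using fun k => exists_abs_poch_div_poch_le (b k) (c k) hρ
  refine ⟨∏ k, C k, fun p => ?_⟩
  rw [lauricellaWeight, abs_prod, ← prod_mul_distrib]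
  refine prod_le_prod (fun _ _ => abs_nonneg _) fun k _ => ?_
  rw [abs_div, abs_mul, Nat.abs_cast, abs_pow, mul_pow, ← mul_div_assoc, ← mul_assoc]
  have := hC k (p k)
  gcongr

/-- The terms of the expansion of the Lauricella series obtained from `hasSum_pochKernel`. -/
noncomputable def expansionTerm {N : ℕ} (a : ℝ) (b c z : Fin (N + 1) → ℝ)
    (x : (ℕ × (Fin N → ℕ)) × (Fin N → ℕ)) : ℝ :=
  pochKernel a x.1.1 x.1.2 x.2 * lauricellaWeight b c z (Fin.cons x.1.1 x.1.2)

theorem summable_expansionTerm {N : ℕ} (a : ℝ) (b c : Fin (N + 1) → ℝ) {z : Fin (N + 1) → ℝ}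
    (hz : ∑ k, |z k| < 1) : Summable (expansionTerm a b c z) := by
  have hZ : 0 ≤ ∑ k, |z k| := sum_nonneg fun _ _ => abs_nonneg _
  set ρ : ℝ := 2 / (1 + ∑ k, |z k|) with hρdef
  have hρ : 1 < ρ := by rw [hρdef, lt_div_iff₀ (by linarith)]; linarith
  have hρ0 : 0 ≤ ρ := by linarith
  have hy : ∑ k, ρ * |z k| < 1 := by
    rw [← mul_sum, hρdef, div_mul_eq_mul_div, div_lt_one (by linarith)]; linarith
  obtain ⟨C, hC⟩ := exists_abs_lauricellaWeight_le b c z hρ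
  have hs := (summable_poch_mul_prod (abs_nonneg a)
    (fun k => mul_nonneg hρ0 (abs_nonneg (z k))) hy).mul_left C
  have hs' := (Fin.consEquiv fun _ : Fin (N + 1) => ℕ).summable_iff.2 hs
  set B : ℕ × (Fin N → ℕ) → ℝ := fun x => C * ∏ k, (ρ * |z k|) ^
    (Fin.cons x.1 x.2 : Fin (N + 1) → ℕ) k /
      (((Fin.cons x.1 x.2 : Fin (N + 1) → ℕ) k).factorial : ℝ) with hB
  have hB0 : ∀ x, 0 ≤ B x := fun x => (abs_nonneg _).trans (hC _)
  have hk0 : ∀ P s (q : Fin N → ℕ), 0 ≤ pochKernel |a| P s q :=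
    fun P s q => (abs_nonneg _).trans (abs_pochKernel_le a P s q)
  refine Summable.of_norm_bounded
    (g := fun x => pochKernel |a| x.1.1 x.1.2 x.2 * B x.1) ?_ fun x => ?_
  · rw [summable_prod_of_nonneg fun x => mul_nonneg (hk0 _ _ _) (hB0 _)]
    refine ⟨fun x => ?_, ?_⟩
    · exact (hasSum_pochKernel |a| x.1 x.2).summable.mul_right (B x)
    refine hs'.congr fun x => ?_
    have h : ∑' q, pochKernel |a| x.1 x.2 q * B x = poch |a| (x.1 + ∑ j, x.2 j) * B x := by
      rw [tsum_mul_right, (hasSum_pochKernel |a| x.1 x.2).tsum_eq]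
    refine Eq.trans ?_ h.symm
    simp only [Function.comp, Fin.consEquiv_apply, hB]
    rw [Fin.sum_univ_succ]
    simp only [Fin.cons_zero, Fin.cons_succ]
    ring
  · rw [Real.norm_eq_abs, expansionTerm, abs_mul]
    exact mul_le_mul (abs_pochKernel_le _ _ _ _) (hC _) (abs_nonneg _) (hk0 _ _ _)

theorem lauricella_eq_tsum_expansionTerm {N : ℕ} (a : ℝ) (b c : Fin (N + 1) → ℝ)
    {z : Fin (N + 1) → ℝ} (hz : ∑ k, |z k| < 1) :
    lauricella a b c z = ∑' x, expansionTerm a b c z x := by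
  rw [(summable_expansionTerm a b c hz).tsum_prod, lauricella,
    ← (Fin.consEquiv fun _ : Fin (N + 1) => ℕ).tsum_eq]
  refine tsum_congr fun x => ?_
  simp only [expansionTerm]
  rw [tsum_mul_right, (hasSum_pochKernel a x.1 x.2).tsum_eq]
  simp only [Fin.consEquiv_apply, lauricellaTerm, lauricellaWeight]
  rw [Fin.sum_univ_succ]
  simp only [Fin.cons_zero, Fin.cons_succ]

/-- The change of summation indices `(q, p, r) ↦ (|q| + p, q + r, q)`. -/
def shiftIndex {N : ℕ} (x : (Fin N → ℕ) × (ℕ × (Fin N → ℕ))) :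
    (ℕ × (Fin N → ℕ)) × (Fin N → ℕ) :=
  ((∑ j, x.1 j + x.2.1, x.1 + x.2.2), x.1)

theorem shiftIndex_injective {N : ℕ} : Function.Injective (shiftIndex (N := N)) := by
  rintro ⟨q, p, r⟩ ⟨q', p', r'⟩ h
  simp only [shiftIndex, Prod.mk.injEq] at h
  obtain ⟨⟨h1, h2⟩, rfl⟩ := h
  rw [Nat.add_left_cancel h1, add_left_cancel h2]

theorem expansionTerm_shiftIndex {N : ℕ} (a : ℝ) (b c z : Fin (N + 1) → ℝ)
    (q : Fin N → ℕ) (p : ℕ) (r : Fin N → ℕ) :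
    expansionTerm a b c z (shiftIndex (q, p, r)) =
      poch a (∑ j, q j) * poch (b 0) (∑ j, q j) * (∏ j, poch (b j.succ) (q j)) /
        ((∏ j, (Nat.factorial (q j) : ℝ)) * poch (c 0) (∑ j, q j) *
          ∏ j, poch (c j.succ) (q j)) *
        z 0 ^ (∑ j, q j) * (∏ j, z j.succ ^ q j) *
        (poch (a + ((∑ j, q j : ℕ) : ℝ)) p * poch (b 0 + ((∑ j, q j : ℕ) : ℝ)) p /
          ((Nat.factorial p : ℝ) * poch (c 0 + ((∑ j, q j : ℕ) : ℝ)) p) * z 0 ^ p) *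
        lauricellaTerm (a + ((∑ j, q j : ℕ) : ℝ)) (fun j => b j.succ + (q j : ℝ))
          (fun j => c j.succ + (q j : ℝ)) (fun j => z j.succ) r := by
  simp only [expansionTerm, shiftIndex]
  rw [pochKernel_add, lauricellaWeight, lauricellaTerm, Fin.prod_univ_succ]
  simp only [Fin.cons_zero, Fin.cons_succ, Pi.add_apply]
  have hP : ((∑ j, q j + p).factorial : ℝ) ≠ 0 := by positivity
  have h1 : (∏ j, ((q j + r j).factorial : ℝ) / ((q j).factorial * (r j).factorial : ℝ)) *
      ∏ j, poch (b j.succ) (q j + r j) / poch (c j.succ) (q j + r j) * z j.succ ^ (q j + r j) /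
        ((q j + r j).factorial : ℝ) =
      (∏ j, poch (b j.succ) (q j)) / ((∏ j, (Nat.factorial (q j) : ℝ)) *
        ∏ j, poch (c j.succ) (q j)) * (∏ j, z j.succ ^ q j) *
      ∏ j, poch (b j.succ + (q j : ℝ)) (r j) / poch (c j.succ + (q j : ℝ)) (r j) *
        z j.succ ^ r j / ((r j).factorial : ℝ) := by
    simp only [← prod_mul_distrib, ← prod_div_distrib]
    refine prod_congr rfl fun j _ => ?_
    have hj : ((q j + r j).factorial : ℝ) ≠ 0 := by positivity
    rw [poch_add, poch_add, pow_add]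
    generalize ((q j + r j).factorial : ℝ) = F at hj
    calc _ = (F * F⁻¹) * (poch (b j.succ) (q j) * poch (b j.succ + q j) (r j) /
          (poch (c j.succ) (q j) * poch (c j.succ + q j) (r j)) *
          (z j.succ ^ q j * z j.succ ^ r j) / ((q j).factorial * (r j).factorial)) := by ring
      _ = _ := by rw [mul_inv_cancel₀ hj]; ring
  have h2 : (((∑ j, q j + p).factorial : ℝ) / (p.factorial : ℝ)) *
      (poch (b 0) (∑ j, q j + p) / poch (c 0) (∑ j, q j + p) * z 0 ^ (∑ j, q j + p) /
        ((∑ j, q j + p).factorial : ℝ)) =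
      poch (b 0) (∑ j, q j) / poch (c 0) (∑ j, q j) * z 0 ^ (∑ j, q j) *
        (poch (b 0 + (∑ j, q j : ℕ)) p / ((p.factorial : ℝ) *
          poch (c 0 + (∑ j, q j : ℕ)) p) * z 0 ^ p) := by
    rw [poch_add, poch_add, pow_add]
    generalize ((∑ j, q j + p).factorial : ℝ) = F at hP
    generalize ((∑ j, q j : ℕ) : ℝ) = M
    calc _ = (F * F⁻¹) * (poch (b 0) (∑ j, q j) * poch (b 0 + M) p /
          (poch (c 0) (∑ j, q j) * poch (c 0 + M) p) *
          (z 0 ^ (∑ j, q j) * z 0 ^ p) / p.factorial) := by ring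
      _ = _ := by rw [mul_inv_cancel₀ hP]; ring
  generalize ((∑ j, q j + p).factorial : ℝ) / (p.factorial : ℝ) = A1 at *
  generalize poch (b 0) (∑ j, q j + p) / poch (c 0) (∑ j, q j + p) * z 0 ^ (∑ j, q j + p) /
        ((∑ j, q j + p).factorial : ℝ) = A2 at *
  generalize (∏ j, ((q j + r j).factorial : ℝ) / ((q j).factorial * (r j).factorial : ℝ)) = B1 at *
  generalize (∏ j, poch (b j.succ) (q j + r j) / poch (c j.succ) (q j + r j) *
    z j.succ ^ (q j + r j) / ((q j + r j).factorial : ℝ)) = B2 at *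
  generalize (∏ j, poch (b j.succ + (q j : ℝ)) (r j) / poch (c j.succ + (q j : ℝ)) (r j) *
        z j.succ ^ r j / ((r j).factorial : ℝ)) = B3 at *
  generalize ((∑ j, q j : ℕ) : ℝ) = M at *
  generalize ∏ j, poch (b j.succ) (q j) = D1 at *
  generalize ∏ j, poch (c j.succ) (q j) = D2 at *
  generalize ∏ j, (Nat.factorial (q j) : ℝ) = D3 at *
  generalize ∏ j, z j.succ ^ q j = D4 at *
  calc _ = poch a (∑ j, q j) * poch (a + M) p * poch (a + M) (∑ j, r j) *
        (A1 * A2) * (B1 * B2) := by ring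
    _ = _ := by rw [h1, h2]; ring

theorem tsum_expansionTerm_shiftIndex {N : ℕ} (a : ℝ) (b c : Fin (N + 1) → ℝ)
    {z : Fin (N + 1) → ℝ} (hz : ∑ k, |z k| < 1) (q : Fin N → ℕ) :
    ∑' x, expansionTerm a b c z (shiftIndex (q, x)) =
      poch a (∑ j, q j) * poch (b 0) (∑ j, q j) * (∏ j, poch (b j.succ) (q j)) /
        ((∏ j, (Nat.factorial (q j) : ℝ)) * poch (c 0) (∑ j, q j) *
          ∏ j, poch (c j.succ) (q j)) *
        z 0 ^ (∑ j, q j) * (∏ j, z j.succ ^ q j) *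
        gaussF (a + ((∑ j, q j : ℕ) : ℝ)) (b 0 + ((∑ j, q j : ℕ) : ℝ))
          (c 0 + ((∑ j, q j : ℕ) : ℝ)) (z 0) *
        lauricella (a + ((∑ j, q j : ℕ) : ℝ)) (fun j => b j.succ + (q j : ℝ))
          (fun j => c j.succ + (q j : ℝ)) (fun j => z j.succ) := by
  have hs := (summable_expansionTerm a b c hz).comp_injective shiftIndex_injective
  refine ((hs.prod_factor q).tsum_prod).trans ?_
  simp only [Function.comp_apply, expansionTerm_shiftIndex, tsum_mul_left, tsum_mul_right,
    gaussF, lauricella]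

/-- formula (23): recursive decomposition of the Lauricella function
`F_A^(n)` (here `n = N + 1 ≥ 2`), as an absolutely convergent sum over
`(m_2,…,m_n) ∈ ℕ^{n−1}`. -/
theorem lauricella_recursive_decomposition (N : ℕ) (hN : 1 ≤ N) (a : ℝ)
    (b c z : Fin (N + 1) → ℝ) (hc : ∀ k, NotNonposInt (c k)) (hz : ∑ k, |z k| < 1) :
    Summable (fun q : Fin N → ℕ =>
      poch a (∑ j, q j) * poch (b 0) (∑ j, q j) * (∏ j, poch (b j.succ) (q j)) /
        ((∏ j, (Nat.factorial (q j) : ℝ)) * poch (c 0) (∑ j, q j) *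
          ∏ j, poch (c j.succ) (q j)) *
        z 0 ^ (∑ j, q j) * (∏ j, z j.succ ^ q j) *
        gaussF (a + ((∑ j, q j : ℕ) : ℝ)) (b 0 + ((∑ j, q j : ℕ) : ℝ))
          (c 0 + ((∑ j, q j : ℕ) : ℝ)) (z 0) *
        lauricella (a + ((∑ j, q j : ℕ) : ℝ)) (fun j => b j.succ + (q j : ℝ))
          (fun j => c j.succ + (q j : ℝ)) (fun j => z j.succ)) ∧
    lauricella a b c z =
      ∑' q : Fin N → ℕ,
        poch a (∑ j, q j) * poch (b 0) (∑ j, q j) * (∏ j, poch (b j.succ) (q j)) /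
          ((∏ j, (Nat.factorial (q j) : ℝ)) * poch (c 0) (∑ j, q j) *
            ∏ j, poch (c j.succ) (q j)) *
          z 0 ^ (∑ j, q j) * (∏ j, z j.succ ^ q j) *
          gaussF (a + ((∑ j, q j : ℕ) : ℝ)) (b 0 + ((∑ j, q j : ℕ) : ℝ))
            (c 0 + ((∑ j, q j : ℕ) : ℝ)) (z 0) *
          lauricella (a + ((∑ j, q j : ℕ) : ℝ)) (fun j => b j.succ + (q j : ℝ))
            (fun j => c j.succ + (q j : ℝ)) (fun j => z j.succ) := by
  have hs := (summable_expansionTerm a b c hz).comp_injective shiftIndex_injective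
  have hterm := fun q => tsum_expansionTerm_shiftIndex a b c hz q
  refine ⟨hs.prod.congr hterm, ?_⟩
  have hsupp : Function.support (expansionTerm a b c z) ⊆ Set.range (shiftIndex (N := N)) := by
    rintro ⟨⟨P, s⟩, q⟩ hx
    obtain ⟨hq, hP⟩ := pochKernel_ne_zero (left_ne_zero_of_mul hx)
    exact ⟨(q, P - ∑ j, q j, s - q), by
      simp only [shiftIndex, Nat.add_sub_cancel' hP, add_tsub_cancel_of_le hq]⟩
  rw [lauricella_eq_tsum_expansionTerm a b c hz, ← shiftIndex_injective.tsum_eq hsupp]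
  exact hs.tsum_prod.trans (tsum_congr hterm)
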